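/- Let n be a fundamental discriminant. Then every element x ∈ M_ℤ with q'(x) = n is projective; consequently, for any x, y ∈ M_ℤ with q'(x) = q'(y) = n there exists g ∈ G_ℤ with g(x) = y. -/

import Mathlib

open Matrix

namespace FreudenthalZ

/-- The integral cubic Jordan algebra `J_ℤ = M₃(ℤ)`. -/
abbrev MatZ := Matrix (Fin 3) (Fin 3) ℤ

/-- The trace bilinear form `(A, B) = tr(A·B)`. -/
def tb (A B : MatZ) : ℤ := (A * B).trace

/-- The Freudenthal cross product `A × B = (A+B)# − A# − B#` (adjoint = adjugate). -/
def cross (A B : MatZ) : MatZ := (A + B).adjugate - A.adjugate - B.adjugate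

/-- The integral Freudenthal module `M_ℤ = ℤ ⊕ ℤ ⊕ J_ℤ ⊕ J_ℤ`, elements `(α, β, A, B)`. -/
abbrev MZ := ℤ × ℤ × MatZ × MatZ

/-- The quartic norm `q'(x) = ((A,B) − αβ)² − 4(A#,B#) + 4α·det A + 4β·det B`. -/
def qz (x : MZ) : ℤ :=
  (tb x.2.2.1 x.2.2.2 - x.1 * x.2.1) ^ 2 - 4 * tb x.2.2.1.adjugate x.2.2.2.adjugate
    + 4 * x.1 * x.2.2.1.det + 4 * x.2.1 * x.2.2.2.det

/-- The symplectic form `{x, y} = αδ − βγ + (A,D) − (B,C)`. -/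
def symp (x y : MZ) : ℤ :=
  x.1 * y.2.1 - x.2.1 * y.1 + tb x.2.2.1 y.2.2.2 - tb x.2.2.2 y.2.2.1

/-- Membership in the group `G_ℤ`: `ℤ`-linear automorphisms of `M_ℤ`
preserving the quartic norm `q'` and the symplectic form `{·,·}`. -/
def InG (g : MZ → MZ) : Prop :=
  IsLinearMap ℤ g ∧ Function.Bijective g ∧
    (∀ x, qz (g x) = qz x) ∧ (∀ x y, symp (g x) (g y) = symp x y)

/-- `x` is projective: some `g ∈ G_ℤ` maps `x` to a diagonal reduced element
`(α, β, diag(a₁,a₂,a₃), 0)` (`α > 0`, `α ∣ β`, `α ∣ aᵢ`) satisfying the three gcd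
conditions `gcd(α·aᵢ, α·β, aⱼ·a_k) = 1`. -/
def Projective (x : MZ) : Prop :=
  ∃ g : MZ → MZ, InG g ∧ ∃ α β a₁ a₂ a₃ : ℤ,
    g x = (α, β, Matrix.diagonal ![a₁, a₂, a₃], 0) ∧
    0 < α ∧ α ∣ β ∧ α ∣ a₁ ∧ α ∣ a₂ ∧ α ∣ a₃ ∧
    Int.gcd (Int.gcd (α * a₁) (α * β)) (a₂ * a₃) = 1 ∧
    Int.gcd (Int.gcd (α * a₂) (α * β)) (a₃ * a₁) = 1 ∧
    Int.gcd (Int.gcd (α * a₃) (α * β)) (a₁ * a₂) = 1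

end FreudenthalZ

open FreudenthalZ

/-- `n` is a fundamental discriminant: either `n` is squarefree and `n ≡ 1 (mod 4)`,
or `n = 4k` with `k` squarefree and `k ≡ 2` or `3 (mod 4)`. -/
def IsFundamentalDiscriminant (n : ℤ) : Prop :=
  (Squarefree n ∧ n % 4 = 1) ∨
    (∃ k : ℤ, n = 4 * k ∧ Squarefree k ∧ (k % 4 = 2 ∨ k % 4 = 3))


namespace FreudenthalZ

def GRel (x y : MZ) : Prop := ∃ g : MZ → MZ, InG g ∧ g x = y

lemma InG.id : InG (fun x => x) :=
  ⟨⟨fun _ _ => rfl, fun _ _ => rfl⟩, Function.bijective_id, fun _ => rfl, fun _ _ => rfl⟩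

lemma InG.comp {f g : MZ → MZ} (hf : InG f) (hg : InG g) : InG (fun x => f (g x)) := by
  obtain ⟨f1, f2, f3, f4⟩ := hf
  obtain ⟨g1, g2, g3, g4⟩ := hg
  refine ⟨⟨fun x y => ?_, fun c x => ?_⟩, f2.comp g2, fun x => ?_, fun x y => ?_⟩
  · rw [g1.map_add, f1.map_add]
  · rw [g1.map_smul, f1.map_smul]
  · rw [f3, g3]
  · rw [f4, g4]

lemma GRel.refl (x : MZ) : GRel x x := ⟨_, InG.id, rfl⟩

lemma GRel.trans {x y z : MZ} (h : GRel x y) (h' : GRel y z) : GRel x z := by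
  obtain ⟨g, hg, rfl⟩ := h
  obtain ⟨f, hf, rfl⟩ := h'
  exact ⟨_, hf.comp hg, rfl⟩

lemma GRel.symm {x y : MZ} (h : GRel x y) : GRel y x := by
  obtain ⟨g, ⟨g1, g2, g3, g4⟩, rfl⟩ := h
  obtain ⟨f, hl, hr⟩ := Function.bijective_iff_has_inverse.1 g2
  refine ⟨f, ⟨⟨fun x y => ?_, fun c x => ?_⟩, ?_, fun x => ?_, fun x y => ?_⟩, hl x⟩
  · apply g2.1; rw [g1.map_add, hr, hr, hr]
  · apply g2.1; rw [g1.map_smul, hr, hr]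
  · exact Function.bijective_iff_has_inverse.2 ⟨g, hr, hl⟩
  · rw [← g3, hr]
  · rw [← g4, hr, hr]

lemma GRel.qz_eq {x y : MZ} (h : GRel x y) : qz y = qz x := by
  obtain ⟨g, ⟨g1, g2, g3, g4⟩, rfl⟩ := h
  exact g3 x

/-- The swap. -/
def sw (x : MZ) : MZ := (-x.2.1, x.1, -x.2.2.2, x.2.2.1)

lemma tb_expand (A B : MatZ) : tb A B =
    A 0 0 * B 0 0 + A 0 1 * B 1 0 + A 0 2 * B 2 0 +
    (A 1 0 * B 0 1 + A 1 1 * B 1 1 + A 1 2 * B 2 1) +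
    (A 2 0 * B 0 2 + A 2 1 * B 1 2 + A 2 2 * B 2 2) := by
  simp [-zsmul_eq_mul, tb, Matrix.trace, Matrix.mul_apply, Fin.sum_univ_three]

lemma sw_InG : InG sw := by
  refine ⟨⟨fun x y => ?_, fun c x => ?_⟩, ?_, fun x => ?_, fun x y => ?_⟩
  · ext <;> simp [-zsmul_eq_mul, sw] <;> ring
  · ext <;> simp [-zsmul_eq_mul, sw]
  · refine Function.bijective_iff_has_inverse.2
      ⟨fun x => (x.2.1, -x.1, x.2.2.2, -x.2.2.1), fun x => ?_, fun x => ?_⟩ <;> simp [-zsmul_eq_mul, sw]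
  · simp [-zsmul_eq_mul, sw, qz, tb_expand, Matrix.adjugate_fin_three, Matrix.det_fin_three]
    ring
  · simp [-zsmul_eq_mul, sw, symp, tb_expand]
    ring

def psi (D : MatZ) (x : MZ) : MZ :=
  (x.1, x.2.1 + tb x.2.2.1 D + tb x.2.2.2 D.adjugate + x.1 * D.det,
    x.2.2.1 + cross x.2.2.2 D + x.1 • D.adjugate, x.2.2.2 + x.1 • D)

def phi (C : MatZ) (x : MZ) : MZ :=
  (x.1 + tb x.2.2.2 C + tb x.2.2.1 C.adjugate + x.2.1 * C.det, x.2.1,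
    x.2.2.1 + x.2.1 • C, x.2.2.2 + cross x.2.2.1 C + x.2.1 • C.adjugate)

lemma psi_zero : psi 0 = fun x => x := by
  funext x
  ext i j <;> simp [-zsmul_eq_mul, psi, cross, tb_expand, Matrix.adjugate_fin_three]

lemma psi_add (D E : MatZ) : psi (D + E) = fun x => psi E (psi D x) := by
  funext x
  refine Prod.ext rfl (Prod.ext ?_ (Prod.ext ?_ ?_))
  · simp [-zsmul_eq_mul, psi, cross, tb_expand, Matrix.adjugate_fin_three, Matrix.det_fin_three]
    ring
  · ext i j
    fin_cases i <;> fin_cases j <;>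
    simp [-zsmul_eq_mul, psi, cross, Matrix.adjugate_fin_three] <;> ring
  · ext i j
    simp [-zsmul_eq_mul, psi]; ring

lemma psi_linear (D : MatZ) : IsLinearMap ℤ (psi D) := by
  refine ⟨fun x y => ?_, fun c x => ?_⟩ <;> refine Prod.ext rfl (Prod.ext ?_ (Prod.ext ?_ ?_))
  · simp [-zsmul_eq_mul, psi, tb_expand]; ring
  · ext i j
    fin_cases i <;> fin_cases j <;>
    simp [-zsmul_eq_mul, psi, cross, Matrix.adjugate_fin_three] <;> ring
  · ext i j
    simp [-zsmul_eq_mul, psi]; ring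
  · simp [-zsmul_eq_mul, psi, tb_expand]; ring
  · ext i j
    fin_cases i <;> fin_cases j <;>
    simp [-zsmul_eq_mul, psi, cross, Matrix.adjugate_fin_three] <;> ring
  · ext i j
    simp [-zsmul_eq_mul, psi]; ring

lemma psi_bij (D : MatZ) : Function.Bijective (psi D) := by
  refine Function.bijective_iff_has_inverse.2 ⟨psi (-D), fun x => ?_, fun x => ?_⟩
  · have := congrFun (psi_add D (-D)) x
    rw [add_neg_cancel, psi_zero] at this
    exact this.symm
  · have := congrFun (psi_add (-D) D) x
    rw [neg_add_cancel, psi_zero] at this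
    exact this.symm

set_option maxHeartbeats 4000000 in
lemma psi_single (i j : Fin 3) (t : ℤ) : InG (psi (Matrix.single i j t)) := by
  refine ⟨psi_linear _, psi_bij _, fun x => ?_, fun x y => ?_⟩
  · obtain ⟨α, β, A, B⟩ := x
    fin_cases i <;> fin_cases j <;>
    simp [-zsmul_eq_mul, psi, qz, cross, tb_expand, Matrix.adjugate_fin_three, Matrix.det_fin_three] <;> ring
  · obtain ⟨α, β, A, B⟩ := x
    obtain ⟨γ, δ, C, D⟩ := y
    fin_cases i <;> fin_cases j <;>
    simp [-zsmul_eq_mul, psi, symp, cross, tb_expand, Matrix.adjugate_fin_three, Matrix.det_fin_three] <;> ring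

lemma psi_InG (D : MatZ) : InG (psi D) := by
  induction D using Matrix.induction_on' with
  | h_zero => rw [psi_zero]; exact InG.id
  | h_add D E hD hE => rw [psi_add]; exact hE.comp hD
  | h_std_basis i j t => exact psi_single i j t

lemma rel_psi (D : MatZ) (x : MZ) : GRel x (psi D x) := ⟨_, psi_InG D, rfl⟩

lemma rel_sw (x : MZ) : GRel x (sw x) := ⟨_, sw_InG, rfl⟩

lemma rel_neg (x : MZ) : GRel x (-x) := by
  have := (rel_sw x).trans (rel_sw _)
  simpa [sw, ← Prod.neg_mk] using this

lemma rel_phi (C : MatZ) (x : MZ) : GRel x (phi C x) := by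
  have := (((rel_sw x).trans (rel_psi (-C) _)).trans (rel_sw _)).trans (rel_neg _)
  convert this using 1
  refine Prod.ext ?_ (Prod.ext ?_ (Prod.ext ?_ ?_))
  · simp [-zsmul_eq_mul, psi, phi, sw, tb_expand, Matrix.adjugate_fin_three, Matrix.det_fin_three]
    ring
  · simp [-zsmul_eq_mul, psi, phi, sw]
  · ext i j
    simp [-zsmul_eq_mul, psi, phi, sw]
  · ext i j
    fin_cases i <;> fin_cases j <;>
    simp [-zsmul_eq_mul, psi, phi, sw, cross, Matrix.adjugate_fin_three] <;> ring

/-- The Levi part. -/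
def levi (P Q P' Q' : MatZ) (x : MZ) : MZ := (x.1, x.2.1, P * x.2.2.1 * Q, Q' * x.2.2.2 * P')

lemma tb_levi (P Q P' Q' A B : MatZ) (hP : P' * P = 1) (hQ : Q * Q' = 1) :
    tb (P * A * Q) (Q' * B * P') = tb A B := by
  have h1 : P * A * Q * (Q' * B * P') = P * (A * B * P') := by
    calc P * A * Q * (Q' * B * P') = P * (A * (Q * Q') * B * P') := by noncomm_ring
      _ = _ := by rw [hQ]; noncomm_ring
  unfold tb
  rw [h1, Matrix.trace_mul_comm, mul_assoc, hP, mul_one]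

lemma levi_InG (P Q P' Q' : MatZ) (hP : P' * P = 1) (hQ : Q * Q' = 1)
    (dP : P.det = 1) (dQ : Q.det = 1) : InG (levi P Q P' Q') := by
  have hP' := mul_eq_one_comm.1 hP
  have hQ' := mul_eq_one_comm.1 hQ
  have dP' : P'.det = 1 := by
    have := congrArg Matrix.det hP
    simpa [dP] using this
  have dQ' : Q'.det = 1 := by
    have := congrArg Matrix.det hQ
    simpa [dQ] using this
  have can : ∀ P Q P' Q' A : MatZ, P' * P = 1 → Q * Q' = 1 → P' * (P * A * Q) * Q' = A := by
    intro P Q P' Q' A h1 h2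
    calc P' * (P * A * Q) * Q' = (P' * P) * A * (Q * Q') := by noncomm_ring
      _ = A := by rw [h1, h2]; simp
  refine ⟨⟨fun x y => ?_, fun c x => ?_⟩, ?_, fun x => ?_, fun x y => ?_⟩
  · simp [-zsmul_eq_mul, levi, mul_add, add_mul]
  · simp [-zsmul_eq_mul, levi]
  · refine Function.bijective_iff_has_inverse.2
      ⟨levi P' Q' P Q, fun x => ?_, fun x => ?_⟩
    · refine Prod.ext rfl (Prod.ext rfl (Prod.ext ?_ ?_))
      · exact can _ _ _ _ _ hP hQ
      · exact can _ _ _ _ _ hQ hP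
    · refine Prod.ext rfl (Prod.ext rfl (Prod.ext ?_ ?_))
      · exact can _ _ _ _ _ hP' hQ'
      · exact can _ _ _ _ _ hQ' hP'
  · have e : tb (P * x.2.2.1 * Q).adjugate (Q' * x.2.2.2 * P').adjugate
        = tb x.2.2.1.adjugate x.2.2.2.adjugate := by
      simp only [Matrix.adjugate_mul_distrib, ← mul_assoc]
      have := tb_levi Q.adjugate P.adjugate Q'.adjugate P'.adjugate x.2.2.1.adjugate
        x.2.2.2.adjugate (by rw [← Matrix.adjugate_mul_distrib, hQ, Matrix.adjugate_one])
        (by rw [← Matrix.adjugate_mul_distrib, hP, Matrix.adjugate_one])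
      simpa only [← mul_assoc] using this
    simp [-zsmul_eq_mul, levi, qz, tb_levi _ _ _ _ _ _ hP hQ, e, dP, dQ, dP', dQ']
  · simp only [levi, symp]
    rw [tb_levi _ _ _ _ _ _ hP hQ, tb_levi Q' P' Q P _ _ hQ hP]

lemma rel_levi (P Q : MatZ) (dP : P.det = 1) (dQ : Q.det = 1) (α β : ℤ) (A : MatZ) :
    GRel (α, β, A, 0) (α, β, P * A * Q, 0) := by
  refine ⟨_, levi_InG P Q P.adjugate Q.adjugate ?_ ?_ dP dQ, ?_⟩
  · rw [Matrix.adjugate_mul, dP, one_smul]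
  · rw [Matrix.mul_adjugate, dQ, one_smul]
  · simp [-zsmul_eq_mul, levi]

lemma rel_row (i j : Fin 3) (h : i ≠ j) (c α β : ℤ) (A : MatZ) :
    GRel (α, β, A, 0) (α, β, Matrix.transvection i j c * A, 0) := by
  simpa using rel_levi (Matrix.transvection i j c) 1 (Matrix.det_transvection_of_ne i j h c)
    Matrix.det_one α β A

lemma rel_col (i j : Fin 3) (h : i ≠ j) (c α β : ℤ) (A : MatZ) :
    GRel (α, β, A, 0) (α, β, A * Matrix.transvection i j c, 0) := by
  simpa using rel_levi 1 (Matrix.transvection i j c) Matrix.det_one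
    (Matrix.det_transvection_of_ne i j h c) α β A

set_option maxHeartbeats 4000000 in
/-- The quadratic move. -/
lemma rel_move (k : Fin 3) (t β : ℤ) (A : MatZ) :
    GRel (1, β, A, 0) (1, β - 2 * t * A.adjugate k k,
      A + Matrix.single k k (β * t - t ^ 2 * A.adjugate k k), 0) := by
  have := (rel_phi (Matrix.single k k t) (1, β, A, 0)).trans
    (rel_psi (-(cross A (Matrix.single k k t))) _)
  convert this using 1
  refine Prod.ext ?_ (Prod.ext ?_ (Prod.ext ?_ ?_))
  · fin_cases k <;>
    simp [-zsmul_eq_mul, psi, phi, tb_expand, Matrix.adjugate_fin_three, Matrix.det_fin_three]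
  · fin_cases k <;>
    simp [-zsmul_eq_mul, psi, phi, cross, tb_expand, Matrix.adjugate_fin_three, Matrix.det_fin_three] <;> ring
  · ext i j
    fin_cases k <;> fin_cases i <;> fin_cases j <;>
    simp [-zsmul_eq_mul, psi, phi, cross, tb_expand, Matrix.adjugate_fin_three, Matrix.det_fin_three] <;> ring
  · ext i j
    fin_cases k <;> fin_cases i <;> fin_cases j <;>
    simp [-zsmul_eq_mul, psi, phi, cross, tb_expand, Matrix.adjugate_fin_three, Matrix.det_fin_three]

lemma min_col {S : Set MatZ} {I : Fin 3 → Prop}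
    (hL : ∀ A ∈ S, ∀ i j c, I i → I j → i ≠ j → Matrix.transvection i j c * A ∈ S)
    {m : ℤ} (hmin : ∀ A ∈ S, ∀ k l, I k → I l → A k l ≠ 0 → |m| ≤ |A k l|)
    {A : MatZ} (hA : A ∈ S) {i j k : Fin 3} (hi : I i) (hj : I j) (hk : I k)
    (hm : A i j = m) (h0 : m ≠ 0) : m ∣ A k j := by
  by_cases hki : k = i
  · subst hki; rw [hm]
  by_contra hd
  have h1 := hL A hA k i (-(A k j / m)) hk hi hki
  have h2 : (Matrix.transvection k i (-(A k j / m)) * A) k j = A k j % m := by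
    rw [Matrix.transvection_mul_apply_same, hm, Int.emod_def]; ring
  have h3 := hmin _ h1 k j hk hj (by
    rw [h2]; intro h; exact hd (Int.dvd_of_emod_eq_zero h))
  rw [h2, abs_of_nonneg (Int.emod_nonneg _ h0)] at h3
  exact absurd (Int.emod_lt_abs (A k j) h0) (not_lt.2 h3)

lemma min_row {S : Set MatZ} {I : Fin 3 → Prop}
    (hR : ∀ A ∈ S, ∀ i j c, I i → I j → i ≠ j → A * Matrix.transvection i j c ∈ S)
    {m : ℤ} (hmin : ∀ A ∈ S, ∀ k l, I k → I l → A k l ≠ 0 → |m| ≤ |A k l|)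
    {A : MatZ} (hA : A ∈ S) {i j k : Fin 3} (hi : I i) (hj : I j) (hk : I k)
    (hm : A i j = m) (h0 : m ≠ 0) : m ∣ A i k := by
  by_cases hki : j = k
  · subst hki; rw [hm]
  by_contra hd
  have h1 := hR A hA j k (-(A i k / m)) hj hk hki
  have h2 : (A * Matrix.transvection j k (-(A i k / m))) i k = A i k % m := by
    rw [Matrix.mul_transvection_apply_same, hm, Int.emod_def]; ring
  have h3 := hmin _ h1 i k hi hk (by
    rw [h2]; intro h; exact hd (Int.dvd_of_emod_eq_zero h))
  rw [h2, abs_of_nonneg (Int.emod_nonneg _ h0)] at h3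
  exact absurd (Int.emod_lt_abs (A i k) h0) (not_lt.2 h3)

lemma min_all {S : Set MatZ} {I : Fin 3 → Prop}
    (hL : ∀ A ∈ S, ∀ i j c, I i → I j → i ≠ j → Matrix.transvection i j c * A ∈ S)
    (hR : ∀ A ∈ S, ∀ i j c, I i → I j → i ≠ j → A * Matrix.transvection i j c ∈ S)
    {m : ℤ} (hmin : ∀ A ∈ S, ∀ k l, I k → I l → A k l ≠ 0 → |m| ≤ |A k l|)
    {A : MatZ} (hA : A ∈ S) {i j k l : Fin 3} (hi : I i) (hj : I j) (hk : I k) (hl : I l)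
    (hm : A i j = m) (h0 : m ≠ 0) : m ∣ A k l := by
  by_cases hki : k = i
  · subst hki; exact min_row hR hmin hA hi hj hl hm h0
  obtain ⟨q, hq⟩ := min_col hL hmin hA hi hj hk hm h0
  have hil := min_row hR hmin hA hi hj hl hm h0
  have hB := hL A hA k i (-q) hk hi hki
  have hC := hL _ hB i k 1 hi hk (Ne.symm hki)
  have e : ∀ c, (Matrix.transvection i k 1 * (Matrix.transvection k i (-q) * A) : MatZ) i c
      = A i c + (A k c - q * A i c) := by
    intro c
    rw [Matrix.transvection_mul_apply_same, Matrix.transvection_mul_apply_same,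
      Matrix.transvection_mul_apply_of_ne _ _ _ _ (Ne.symm hki)]
    ring
  have h := min_row hR hmin hC hi hj hl (by rw [e, hq, hm]; ring) h0
  rw [e] at h
  have h' := (Int.dvd_add_right hil).1 h
  simpa using dvd_add h' (hil.mul_left q)

lemma gen {S : Set MatZ} {I : Fin 3 → Prop}
    (hL : ∀ A ∈ S, ∀ i j c, I i → I j → i ≠ j → Matrix.transvection i j c * A ∈ S)
    (hR : ∀ A ∈ S, ∀ i j c, I i → I j → i ≠ j → A * Matrix.transvection i j c ∈ S)
    (hne : ∃ A ∈ S, ∃ i j, I i ∧ I j ∧ A i j ≠ 0) :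
    ∃ A ∈ S, ∃ i j, I i ∧ I j ∧ A i j ≠ 0 ∧
      ∀ A' ∈ S, A' i j = A i j → ∀ k l, I k → I l → A i j ∣ A' k l := by
  classical
  have hex : ∃ n : ℕ, ∃ A ∈ S, ∃ i j, I i ∧ I j ∧ A i j ≠ 0 ∧ (A i j).natAbs = n := by
    obtain ⟨A, hA, i, j, hi, hj, h⟩ := hne
    exact ⟨_, A, hA, i, j, hi, hj, h, rfl⟩
  obtain ⟨A, hA, i, j, hi, hj, h0, hn⟩ := Nat.find_spec hex
  refine ⟨A, hA, i, j, hi, hj, h0, fun A' hA' he k l hk hl => ?_⟩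
  refine min_all hL hR (m := A i j) ?_ hA' hi hj hk hl he h0
  intro B hB k l hk hl hB0
  have := Nat.find_min' hex ⟨B, hB, k, l, hk, hl, hB0, rfl⟩
  rw [← hn] at this
  rw [Int.abs_eq_natAbs, Int.abs_eq_natAbs]
  exact_mod_cast this

lemma unit_sq {u : ℤ} (hu : u.natAbs = 1) : u * u = 1 := by
  rcases Int.natAbs_eq u with h | h <;> rw [h, hu] <;> norm_num

lemma unit_to_row {S : Set MatZ} {I : Fin 3 → Prop}
    (hL : ∀ A ∈ S, ∀ i j c, I i → I j → i ≠ j → Matrix.transvection i j c * A ∈ S)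
    {p p' : Fin 3} (hp : I p) (hp' : I p') (hpp : p ≠ p')
    {A : MatZ} (hA : A ∈ S) {i j : Fin 3} (hi : I i) (hu : (A i j).natAbs = 1) :
    ∃ A' ∈ S, A' p j = 1 := by
  have key : ∀ A ∈ S, ∀ i k, I i → I k → k ≠ i → (A i j).natAbs = 1 → ∃ A' ∈ S, A' k j = 1 := by
    intro A hA i k hi hk hki hu
    refine ⟨_, hL A hA k i ((1 - A k j) * A i j) hk hi hki, ?_⟩
    rw [Matrix.transvection_mul_apply_same, mul_assoc, unit_sq hu]; ring
  by_cases h : p = i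
  · subst h
    obtain ⟨A', h1, h2⟩ := key A hA p p' hi hp' hpp.symm hu
    exact key A' h1 p' p hp' hp hpp (by rw [h2]; rfl)
  · exact key A hA i p hi hp h hu

lemma unit_to_col {S : Set MatZ} {I : Fin 3 → Prop}
    (hR : ∀ A ∈ S, ∀ i j c, I i → I j → i ≠ j → A * Matrix.transvection i j c ∈ S)
    {p p' : Fin 3} (hp : I p) (hp' : I p') (hpp : p ≠ p')
    {A : MatZ} (hA : A ∈ S) {i j : Fin 3} (hj : I j) (hu : (A i j).natAbs = 1) :
    ∃ A' ∈ S, A' i p = 1 := by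
  have key : ∀ A ∈ S, ∀ j k, I j → I k → j ≠ k → (A i j).natAbs = 1 → ∃ A' ∈ S, A' i k = 1 := by
    intro A hA j k hj hk hki hu
    refine ⟨_, hR A hA j k ((1 - A i k) * A i j) hj hk hki, ?_⟩
    rw [Matrix.mul_transvection_apply_same, mul_assoc, unit_sq hu]; ring
  by_cases h : j = p
  · subst h
    obtain ⟨A', h1, h2⟩ := key A hA j p' hj hp' hpp hu
    exact key A' h1 p' j hp' hp hpp.symm (by rw [h2]; rfl)
  · exact key A hA j p hj hp h hu

lemma clear_one {S : Set MatZ} {I : Fin 3 → Prop}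
    (hL : ∀ A ∈ S, ∀ i j c, I i → I j → i ≠ j → Matrix.transvection i j c * A ∈ S)
    (hR : ∀ A ∈ S, ∀ i j c, I i → I j → i ≠ j → A * Matrix.transvection i j c ∈ S)
    {p k : Fin 3} (hp : I p) (hk : I k) (hpk : p ≠ k) {A : MatZ} (hA : A ∈ S)
    (h1 : A p p = 1) : ∃ A' ∈ S, A' p p = 1 ∧ A' k p = 0 ∧ A' p k = 0 ∧
      ∀ l, l ≠ p → l ≠ k → A' l p = A l p ∧ A' p l = A p l := by
  refine ⟨_, hR _ (hL A hA k p (-(A k p)) hk hp hpk.symm) p k (-(A p k)) hp hk hpk, ?_, ?_, ?_, ?_⟩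
  · rw [Matrix.mul_transvection_apply_of_ne _ _ _ _ hpk,
      Matrix.transvection_mul_apply_of_ne _ _ _ _ hpk, h1]
  · rw [Matrix.mul_transvection_apply_of_ne _ _ _ _ hpk,
      Matrix.transvection_mul_apply_same, h1]; ring
  · rw [Matrix.mul_transvection_apply_same,
      Matrix.transvection_mul_apply_of_ne _ _ _ _ hpk,
      Matrix.transvection_mul_apply_of_ne _ _ _ _ hpk, h1]; ring
  · intro l hlp hlk
    rw [Matrix.mul_transvection_apply_of_ne _ _ _ _ hpk,
      Matrix.transvection_mul_apply_of_ne _ _ _ _ hlk,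
      Matrix.mul_transvection_apply_of_ne _ _ _ _ hlk,
      Matrix.transvection_mul_apply_of_ne _ _ _ _ hpk]
    exact ⟨rfl, rfl⟩

lemma fund_unit {n c e f : ℤ} (hn : IsFundamentalDiscriminant n) (h : n = c ^ 2 * (e ^ 2 + 4 * f)) :
    c.natAbs = 1 := by
  rw [← Int.isUnit_iff_natAbs_eq]
  rcases hn with ⟨hs, -⟩ | ⟨k, hk, hs, hm⟩
  · exact hs c ⟨e ^ 2 + 4 * f, by rw [h]; ring⟩
  · rcases Int.even_or_odd' c with ⟨d, hd | hd⟩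
    · exfalso
      have h1 : k = d ^ 2 * (e ^ 2 + 4 * f) := by
        rw [hk, hd] at h; linarith [h]
      have hu : IsUnit d := hs d ⟨e ^ 2 + 4 * f, by rw [h1]; ring⟩
      have hu2 : d ^ 2 = 1 := by rw [pow_two]; exact Int.isUnit_mul_self hu
      rw [hu2, one_mul] at h1
      rcases Int.even_or_odd' e with ⟨g, hg | hg⟩
      · have : k = 4 * (g ^ 2 + f) := by rw [h1, hg]; ring
        omega
      · have : k = 4 * (g ^ 2 + g + f) + 1 := by rw [h1, hg]; ring
        omega
    · rcases Int.even_or_odd' e with ⟨g, hg | hg⟩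
      · exact hs c ⟨g ^ 2 + f, by
          have : 4 * k = 4 * (c * c * (g ^ 2 + f)) := by rw [← hk, h, hg]; ring
          linarith⟩
      · exfalso
        have : 4 * k = 4 * ((d^2+d) * (e^2 + 4 * f) + g ^ 2 + g + f) + 1 := by
          rw [← hk, h, hd, hg]; ring
        omega

lemma fund_ne {n : ℤ} (hn : IsFundamentalDiscriminant n) : n ≠ 0 := by
  rcases hn with ⟨hs, -⟩ | ⟨k, hk, hs, -⟩
  · exact hs.ne_zero
  · have := hs.ne_zero
    omega

lemma phi_fst (i j : Fin 3) (t : ℤ) (x : MZ) :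
    (phi (Matrix.single j i t) x).1 = x.1 + t * x.2.2.2 i j := by
  fin_cases i <;> fin_cases j <;>
  simp [-zsmul_eq_mul, phi, tb_expand, Matrix.adjugate_fin_three, Matrix.det_fin_three] <;> ring

lemma pos_of_ne {x y : MZ} (h : GRel x y) (h0 : y.1 ≠ 0) :
    ∃ m : ℕ, 0 < m ∧ ∃ z, GRel x z ∧ z.1 = m := by
  rcases lt_or_gt_of_ne h0 with h1 | h1
  · exact ⟨(-y.1).toNat, by omega, -y, h.trans (rel_neg y), by simp; omega⟩
  · exact ⟨y.1.toNat, by omega, y, h, by omega⟩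

lemma exists_pos (x : MZ) (hx : x ≠ 0) : ∃ m : ℕ, 0 < m ∧ ∃ z, GRel x z ∧ z.1 = m := by
  by_contra hno
  have H : ∀ y, GRel x y → y.1 = 0 := by
    intro y hy
    by_contra h0
    exact hno (pos_of_ne hy h0)
  have HB : ∀ y, GRel x y → y.2.2.2 = 0 := by
    intro y hy
    ext i j
    have h1 := H _ (hy.trans (rel_phi (Matrix.single j i 1) y))
    rw [phi_fst, H y hy] at h1
    simpa using h1
  apply hx
  have h1 := H x (GRel.refl x)
  have h2 := HB x (GRel.refl x)
  have h3 := H _ (rel_sw x)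
  have h4 := HB _ (rel_sw x)
  refine Prod.ext h1 (Prod.ext ?_ (Prod.ext ?_ h2))
  · simpa [sw] using h3
  · simpa [sw] using h4

lemma reduce_alpha (x : MZ) (hx : x ≠ 0) : ∃ α β : ℤ, ∃ A : MatZ, 0 < α ∧
    GRel x (α, β, A, 0) ∧ α ∣ β ∧ ∀ i j, α ∣ A i j := by
  classical
  have hex := exists_pos x hx
  obtain ⟨hm, z, hz, hzm⟩ := Nat.find_spec hex
  set m := Nat.find hex with hmdef
  have hmin : ∀ y, GRel x y → 0 < y.1 → (m : ℤ) ≤ y.1 := by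
    intro y hy h0
    have := Nat.find_min' hex (m := y.1.toNat) ⟨by omega, y, hy, by omega⟩
    omega
  have hm' : (0 : ℤ) < m := by exact_mod_cast hm
  have hB : ∀ y, GRel x y → y.1 = m → ∀ i j, (m : ℤ) ∣ y.2.2.2 i j := by
    intro y hy hym i j
    by_contra hd
    set r := y.2.2.2 i j % m with hr
    have hr0 : 0 ≤ r := Int.emod_nonneg _ hm'.ne'
    have hr1 : r < m := Int.emod_lt_of_pos _ hm'
    have hr2 : r ≠ 0 := fun h => hd (Int.dvd_of_emod_eq_zero h)
    have h1 := hy.trans (rel_psi (Matrix.single i j (-(y.2.2.2 i j / m))) y)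
    have h2 := h1.trans (rel_phi (Matrix.single j i (-1)) _)
    have e : (phi (Matrix.single j i (-1))
        (psi (Matrix.single i j (-(y.2.2.2 i j / m))) y)).1 = m - r := by
      rw [phi_fst]
      simp [-zsmul_eq_mul, psi, hym, hr, Int.emod_def]
      ring
    have := hmin _ h2 (by rw [e]; omega)
    rw [e] at this
    omega
  obtain ⟨β, A, hA⟩ : ∃ β A, GRel x ((m : ℤ), β, A, 0) := by
    choose D hD using hB z hz hzm
    have h1 := hz.trans (rel_psi (-(Matrix.of D)) z)
    refine ⟨(psi (-(Matrix.of D)) z).2.1, (psi (-(Matrix.of D)) z).2.2.1, ?_⟩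
    convert h1 using 1
    refine Prod.ext hzm.symm (Prod.ext rfl (Prod.ext rfl ?_))
    ext i j
    simp [-zsmul_eq_mul, psi, hzm, hD]
  have hAd : ∀ i j, (m : ℤ) ∣ A i j := by
    have key : ∀ k l i j, (m : ℤ) ∣ cross A (Matrix.single k l 1) i j := by
      intro k l i j
      have h1 := hA.trans (rel_phi (Matrix.single k l 1) _)
      have h2 := hB _ h1 (by rw [phi_fst]; simp) i j
      have e : (phi (Matrix.single k l 1) ((m : ℤ), β, A, 0)).2.2.2 i j =
          cross A (Matrix.single k l 1) i j := by
        fin_cases k <;> fin_cases l <;> fin_cases i <;> fin_cases j <;>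
        simp [-zsmul_eq_mul, phi, Matrix.adjugate_fin_three]
      rwa [e] at h2
    have k1 : (m : ℤ) ∣ A 2 2 := by
      have h := key 0 0 1 1
      simp only [cross, Matrix.adjugate_fin_three] at h
      simp at h
      ring_nf at h
      simpa using h
    have k2 : (m : ℤ) ∣ A 1 1 := by
      have h := key 0 0 2 2
      simp only [cross, Matrix.adjugate_fin_three] at h
      simp at h
      ring_nf at h
      simpa using h
    have k3 : (m : ℤ) ∣ A 1 2 := by
      have h := key 0 0 1 2
      simp only [cross, Matrix.adjugate_fin_three] at h
      simp at h
      ring_nf at h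
      simpa using h
    have k4 : (m : ℤ) ∣ A 2 1 := by
      have h := key 0 0 2 1
      simp only [cross, Matrix.adjugate_fin_three] at h
      simp at h
      ring_nf at h
      simpa using h
    have k5 : (m : ℤ) ∣ A 0 0 := by
      have h := key 1 1 2 2
      simp only [cross, Matrix.adjugate_fin_three] at h
      simp at h
      ring_nf at h
      simpa using h
    have k6 : (m : ℤ) ∣ A 0 2 := by
      have h := key 1 1 0 2
      simp only [cross, Matrix.adjugate_fin_three] at h
      simp at h
      ring_nf at h
      simpa using h
    have k7 : (m : ℤ) ∣ A 2 0 := by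
      have h := key 1 1 2 0
      simp only [cross, Matrix.adjugate_fin_three] at h
      simp at h
      ring_nf at h
      simpa using h
    have k8 : (m : ℤ) ∣ A 0 1 := by
      have h := key 2 2 0 1
      simp only [cross, Matrix.adjugate_fin_three] at h
      simp at h
      ring_nf at h
      simpa using h
    have k9 : (m : ℤ) ∣ A 1 0 := by
      have h := key 2 2 1 0
      simp only [cross, Matrix.adjugate_fin_three] at h
      simp at h
      ring_nf at h
      simpa using h
    intro i j
    fin_cases i <;> fin_cases j
    exacts [k5, k8, k6, k9, k2, k3, k7, k4, k1]
  refine ⟨m, β, A, hm', hA, ?_, hAd⟩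
  by_contra hd
  obtain ⟨a0, h0⟩ := hAd 0 0
  obtain ⟨a1, h1⟩ := hAd 1 1
  obtain ⟨a2, h2⟩ := hAd 2 2
  have key : ∀ t, GRel x (sw (psi (Matrix.diagonal ![1, 1 - a2, t]) ((m : ℤ), β, A, 0))) :=
    fun t => (hA.trans (rel_psi _ _)).trans (rel_sw _)
  have e : ∀ t, (sw (psi (Matrix.diagonal ![1, 1 - a2, t]) ((m : ℤ), β, A, 0))).1 =
      -(β + m * (a0 + a1 * (1 - a2) + t)) := by
    intro t
    simp [sw, psi, tb_expand, Fin.prod_univ_three, h0, h1, h2]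
    ring
  have h3 := (key (-(β / m) - 1 - (a0 + a1 * (1 - a2))))
  have h4 := hmin _ h3
  rw [e] at h4
  have h5 : -(β + m * (a0 + a1 * (1 - a2) + (-(β / m) - 1 - (a0 + a1 * (1 - a2))))) =
      m - β % m := by
    rw [Int.emod_def]; ring
  rw [h5] at h4
  have hr0 : 0 ≤ β % m := Int.emod_nonneg _ hm'.ne'
  have hr1 : β % m < m := Int.emod_lt_of_pos _ hm'
  have hr2 : β % m ≠ 0 := fun h => hd (Int.dvd_of_emod_eq_zero h)
  have := h4 (by omega)
  omega

lemma qz_B0 (α β : ℤ) (A : MatZ) : qz (α, β, A, 0) = (α * β) ^ 2 + 4 * α * A.det := by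
  simp [qz, tb_expand, Matrix.adjugate_fin_three]

lemma dvd_matrix {m : ℤ} {A : MatZ} (h : ∀ i j, m ∣ A i j) : ∃ A0 : MatZ, A = m • A0 := by
  choose D hD using h
  exact ⟨Matrix.of D, by ext i j; simp [-zsmul_eq_mul, hD]⟩

lemma reduce_one {n : ℤ} (hn : IsFundamentalDiscriminant n) (x : MZ) (hx : qz x = n) :
    ∃ β A, GRel x (1, β, A, 0) := by
  have hx0 : x ≠ 0 := by
    rintro rfl
    apply fund_ne hn
    rw [← hx]
    simp [qz, tb_expand, Matrix.adjugate_fin_three]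
  obtain ⟨α, β, A, hα, hr, ⟨b, rfl⟩, hA⟩ := reduce_alpha x hx0
  obtain ⟨A0, rfl⟩ := dvd_matrix hA
  have hq := hr.qz_eq
  rw [hx, qz_B0, Matrix.det_smul] at hq
  have := fund_unit hn (c := α) (e := α * b) (f := α ^ 2 * A0.det) (by rw [← hq]; simp; ring)
  have h1 : α = 1 := by omega
  subst h1
  exact ⟨_, _, hr⟩

lemma reduce_two {n : ℤ} (hn : IsFundamentalDiscriminant n) (x : MZ) (hx : qz x = n) :
    ∃ β A, GRel x (1, β, A, 0) ∧ A 0 0 = 1 ∧ A 1 0 = 0 ∧ A 2 0 = 0 ∧ A 0 1 = 0 ∧ A 0 2 = 0 := by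
  set S : Set MatZ := {A | ∃ β, GRel x (1, β, A, 0)} with hS
  have hL : ∀ A ∈ S, ∀ i j c, (fun _ : Fin 3 => True) i → (fun _ : Fin 3 => True) j → i ≠ j →
      Matrix.transvection i j c * A ∈ S := by
    rintro A ⟨β, hA⟩ i j c - - hij
    exact ⟨β, hA.trans (rel_row i j hij c 1 β A)⟩
  have hR : ∀ A ∈ S, ∀ i j c, (fun _ : Fin 3 => True) i → (fun _ : Fin 3 => True) j → i ≠ j →
      A * Matrix.transvection i j c ∈ S := by
    rintro A ⟨β, hA⟩ i j c - - hij
    exact ⟨β, hA.trans (rel_col i j hij c 1 β A)⟩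
  have hq : ∀ β A, GRel x (1, β, A, 0) → n = β ^ 2 + 4 * A.det := by
    intro β A h
    have := h.qz_eq
    rw [hx, qz_B0] at this
    rw [← this]; ring
  have hne : ∃ A ∈ S, ∃ i j, (fun _ : Fin 3 => True) i ∧ (fun _ : Fin 3 => True) j ∧
      A i j ≠ 0 := by
    obtain ⟨β, A, hA⟩ := reduce_one hn x hx
    by_cases h0 : A = 0
    · subst h0
      have h1 := hA.trans (rel_move 0 1 β 0)
      refine ⟨_, ⟨_, h1⟩, 0, 0, trivial, trivial, ?_⟩
      have h2 := hq _ _ hA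
      have h3 := fund_ne hn
      have : β ≠ 0 := by
        rintro rfl
        apply h3; rw [h2]; simp [Matrix.det_fin_three]
      simpa [Matrix.adjugate_fin_three] using this
    · by_contra hno
      push Not at hno
      exact h0 (by ext i j; exact hno A ⟨β, hA⟩ i j trivial trivial)
  obtain ⟨A, ⟨β, hA⟩, i, j, -, -, h0, hd⟩ := gen hL hR hne
  have hdA : ∀ k l, A i j ∣ A k l := fun k l => hd A ⟨β, hA⟩ rfl k l trivial trivial
  have hadj : ∀ k l, A i j ∣ A.adjugate k l := by
    intro k l
    rw [Matrix.adjugate_fin_three]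
    fin_cases k <;> fin_cases l <;> simp <;>
      first
      | exact dvd_sub (Dvd.dvd.mul_right (hdA _ _) _) (Dvd.dvd.mul_right (hdA _ _) _)
      | exact dvd_add (((dvd_neg).2 (Dvd.dvd.mul_right (hdA _ _) _))) (Dvd.dvd.mul_right (hdA _ _) _)
  obtain ⟨k, hk⟩ : ∃ k : Fin 3, k ≠ i := exists_ne i
  have h1 := hd _ ⟨_, hA.trans (rel_move k 1 β A)⟩ (by simp [Matrix.single_apply, hk]) k k
    trivial trivial
  simp only [Matrix.add_apply, Matrix.single_apply_same, mul_one, one_pow, one_mul] at h1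
  have hβ : A i j ∣ β := by
    have h2 := dvd_add (dvd_sub h1 (hdA k k)) (hadj k k)
    have e : A k k + (β - A.adjugate k k) - A k k + A.adjugate k k = β := by ring
    rwa [e] at h2
  have hu : (A i j).natAbs = 1 := by
    obtain ⟨b, hb⟩ := hβ
    obtain ⟨A0, hA0⟩ := dvd_matrix hdA
    have h2 := hq _ _ hA
    generalize A i j = a at *
    rw [hb, hA0, Matrix.det_smul] at h2
    exact fund_unit hn (c := a) (e := b) (f := a * A0.det) (by rw [h2]; simp; ring)
  obtain ⟨A1, hA1, hu1⟩ := unit_to_row hL (p := 0) (p' := 1) trivial trivial (by decide)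
    ⟨β, hA⟩ trivial hu
  obtain ⟨A2, hA2, hu2⟩ := unit_to_col hR (p := 0) (p' := 1) trivial trivial (by decide)
    hA1 (j := j) trivial (by rw [hu1]; rfl)
  obtain ⟨A3, hA3, hu3, a, b, -⟩ := clear_one hL hR (p := 0) (k := 1) trivial trivial (by decide)
    hA2 hu2
  obtain ⟨A4, ⟨β', hA4⟩, hu4, c, d, e⟩ := clear_one hL hR (p := 0) (k := 2) trivial trivial
    (by decide) hA3 hu3
  obtain ⟨e1, e2⟩ := e 1 (by decide) (by decide)
  exact ⟨β', A4, hA4, hu4, by rw [e1, a], c, by rw [e2, b], d⟩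

lemma reduce_three {n : ℤ} (hn : IsFundamentalDiscriminant n) (x : MZ) (hx : qz x = n) :
    ∃ β k, GRel x (1, β, Matrix.diagonal ![1, 1, k], 0) := by
  set S : Set MatZ := {A | ∃ β, GRel x (1, β, A, 0) ∧ A 0 0 = 1 ∧ A 1 0 = 0 ∧ A 2 0 = 0 ∧
    A 0 1 = 0 ∧ A 0 2 = 0} with hS
  have hL : ∀ A ∈ S, ∀ i j c, (fun i : Fin 3 => i ≠ 0) i → (fun i : Fin 3 => i ≠ 0) j → i ≠ j →
      Matrix.transvection i j c * A ∈ S := by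
    rintro A ⟨β, hA, h1, h2, h3, h4, h5⟩ i j c hi hj hij
    refine ⟨β, hA.trans (rel_row i j hij c 1 β A), ?_⟩
    simp only [Matrix.transvection_mul_apply_of_ne _ _ _ _ hi.symm, h1, h4, h5]
    fin_cases i <;> fin_cases j <;>
      simp_all [Matrix.transvection, Matrix.add_mul]
  have hR : ∀ A ∈ S, ∀ i j c, (fun i : Fin 3 => i ≠ 0) i → (fun i : Fin 3 => i ≠ 0) j → i ≠ j →
      A * Matrix.transvection i j c ∈ S := by
    rintro A ⟨β, hA, h1, h2, h3, h4, h5⟩ i j c hi hj hij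
    refine ⟨β, hA.trans (rel_col i j hij c 1 β A), ?_⟩
    simp only [Matrix.mul_transvection_apply_of_ne _ _ _ _ hj.symm, h1, h2, h3]
    fin_cases i <;> fin_cases j <;>
      simp_all [Matrix.transvection, Matrix.mul_add]
  have hM : ∀ A β k, GRel x (1, β, A, 0) → A ∈ S → k ≠ 0 →
      A + Matrix.single k k (β * 1 - 1 ^ 2 * A.adjugate k k) ∈ S := by
    rintro A β k hA ⟨-, -, h1, h2, h3, h4, h5⟩ hk
    refine ⟨_, hA.trans (rel_move k 1 β A), ?_⟩
    simp [Matrix.single_apply, hk, h1, h2, h3, h4, h5]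
  have hdet : ∀ A ∈ S, A.det = A 1 1 * A 2 2 - A 1 2 * A 2 1 := by
    rintro A ⟨-, -, h1, h2, h3, h4, h5⟩
    simp [Matrix.det_fin_three, h1, h2, h3, h4, h5]
  have hq : ∀ β A, GRel x (1, β, A, 0) → n = β ^ 2 + 4 * A.det := by
    intro β A h
    have := h.qz_eq
    rw [hx, qz_B0] at this
    rw [← this]; ring
  have hadj1 : ∀ A ∈ S, A.adjugate 1 1 = A 2 2 := by
    rintro A ⟨-, -, h1, h2, h3, h4, h5⟩
    simp [Matrix.adjugate_fin_three, h1, h2, h3, h4, h5]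
  have hadj2 : ∀ A ∈ S, A.adjugate 2 2 = A 1 1 := by
    rintro A ⟨-, -, h1, h2, h3, h4, h5⟩
    simp [Matrix.adjugate_fin_three, h1, h2, h3, h4, h5]
  have hne : ∃ A ∈ S, ∃ i j, (fun i : Fin 3 => i ≠ 0) i ∧ (fun i : Fin 3 => i ≠ 0) j ∧
      A i j ≠ 0 := by
    obtain ⟨β, A, hA, hA'⟩ := reduce_two hn x hx
    have hAS : A ∈ S := ⟨β, hA, hA'⟩
    by_contra hno
    push Not at hno
    have hz : ∀ B ∈ S, ∀ i j : Fin 3, i ≠ 0 → j ≠ 0 → B i j = 0 :=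
      fun B hB i j hi hj => hno B hB i j hi hj
    have h1 := hz _ (hM A β 1 hA hAS (by decide)) 1 1 (by decide) (by decide)
    rw [hadj1 A hAS] at h1
    have z11 := hz A hAS 1 1 (by decide) (by decide)
    have z12 := hz A hAS 1 2 (by decide) (by decide)
    have z21 := hz A hAS 2 1 (by decide) (by decide)
    have z22 := hz A hAS 2 2 (by decide) (by decide)
    simp [z11, z22] at h1
    have h2 := hq _ _ hA
    rw [hdet A hAS, h1, z11, z12] at h2
    exact fund_ne hn (by rw [h2]; ring)
  obtain ⟨A, hAS, i, j, hi, hj, h0, hd⟩ := gen hL hR hne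
  obtain ⟨β, hA, hA'⟩ := id hAS
  have hdA : ∀ k l, k ≠ 0 → l ≠ 0 → A i j ∣ A k l := fun k l => hd A hAS rfl k l
  have hadj : ∀ k, k ≠ 0 → A i j ∣ A.adjugate k k := by
    intro k hk
    have : k = 1 ∨ k = 2 := by omega
    rcases this with rfl | rfl
    · rw [hadj1 A hAS]; exact hdA _ _ (by decide) (by decide)
    · rw [hadj2 A hAS]; exact hdA _ _ (by decide) (by decide)
  obtain ⟨k, hk, hk0⟩ : ∃ k : Fin 3, k ≠ i ∧ k ≠ 0 := by
    clear * -
    revert i; decide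
  have h1 := hd _ (hM A β k hA hAS hk0) (by simp [Matrix.single_apply, hk]) k k hk0 hk0
  simp only [Matrix.add_apply, Matrix.single_apply_same, mul_one, one_pow, one_mul] at h1
  have hβ : A i j ∣ β := by
    have h2 := dvd_add (dvd_sub h1 (hdA k k hk0 hk0)) (hadj k hk0)
    have e : A k k + (β - A.adjugate k k) - A k k + A.adjugate k k = β := by ring
    rwa [e] at h2
  have hu : (A i j).natAbs = 1 := by
    obtain ⟨b, hb⟩ := hβ
    obtain ⟨a11, h11⟩ := hdA 1 1 (by decide) (by decide)
    obtain ⟨a12, h12⟩ := hdA 1 2 (by decide) (by decide)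
    obtain ⟨a21, h21⟩ := hdA 2 1 (by decide) (by decide)
    obtain ⟨a22, h22⟩ := hdA 2 2 (by decide) (by decide)
    have h2 := hq _ _ hA
    rw [hdet A hAS, h11, h12, h21, h22, hb] at h2
    exact fund_unit hn (c := A i j) (e := b) (f := a11 * a22 - a12 * a21) (by rw [h2]; ring)
  obtain ⟨A1, hA1, hu1⟩ := unit_to_row hL (p := 1) (p' := 2) (by decide) (by decide) (by decide)
    hAS hi hu
  obtain ⟨A2, hA2, hu2⟩ := unit_to_col hR (p := 1) (p' := 2) (by decide) (by decide) (by decide)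
    hA1 (j := j) hj (by rw [hu1]; rfl)
  obtain ⟨A3, ⟨β', hA3, h1, h2, h3, h4, h5⟩, hu3, a, b, -⟩ :=
    clear_one hL hR (p := 1) (k := 2) (by decide) (by decide) (by decide) hA2 hu2
  refine ⟨β', A3 2 2, ?_⟩
  have e : A3 = Matrix.diagonal ![1, 1, A3 2 2] := by
    ext i j
    fin_cases i <;> fin_cases j <;> simp [*]
  rw [← e]
  exact hA3

lemma reduce_four {n : ℤ} (hn : IsFundamentalDiscriminant n) (x : MZ) (hx : qz x = n) :
    GRel x (1, n % 2, Matrix.diagonal ![1, 1, n / 4], 0) := by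
  obtain ⟨β, k, h⟩ := reduce_three hn x hx
  have h1 := h.trans (rel_move 2 (β / 2) β _)
  have e1 : (Matrix.diagonal ![1, 1, k] : MatZ).adjugate 2 2 = 1 := by
    rw [Matrix.adjugate_fin_three]; simp
  rw [e1] at h1
  have e2 : (Matrix.diagonal ![1, 1, k] : MatZ) +
      Matrix.single 2 2 (β * (β / 2) - (β / 2) ^ 2 * 1) =
      Matrix.diagonal ![1, 1, k + (β * (β / 2) - (β / 2) ^ 2)] := by
    ext i j
    fin_cases i <;> fin_cases j <;> simp
  rw [e2] at h1
  generalize k + (β * (β / 2) - (β / 2) ^ 2) = k' at h1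
  have e3 : β - 2 * (β / 2) * 1 = β % 2 := by omega
  rw [e3] at h1
  have hq := h1.qz_eq
  rw [hx, qz_B0] at hq
  have hd : (Matrix.diagonal ![1, 1, k'] : MatZ).det = k' := by
    simp [Fin.prod_univ_three]
  rw [hd] at hq
  have h01 : β % 2 = 0 ∨ β % 2 = 1 := by omega
  have e4 : β % 2 = n % 2 ∧ k' = n / 4 := by
    rcases h01 with h | h <;> rw [h] at hq ⊢ <;> constructor <;> omega
  rw [← e4.1, ← e4.2]
  exact h1

end FreudenthalZ

/-- **Elements of fundamental discriminant norm are projective.**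
If `n` is a fundamental discriminant then every `x ∈ M_ℤ` with `q'(x) = n` is
projective; consequently `G_ℤ` acts transitively on the set of elements of norm `n`. -/
theorem fundamental_discriminant_projective (n : ℤ) (hn : IsFundamentalDiscriminant n) :
    (∀ x : MZ, qz x = n → Projective x) ∧
    (∀ x y : MZ, qz x = n → qz y = n → ∃ g : MZ → MZ, InG g ∧ g x = y) := by
  refine ⟨fun x hx => ?_, fun x y hx hy => ?_⟩
  · obtain ⟨g, hg, e⟩ := reduce_four hn x hx
    refine ⟨g, hg, 1, n % 2, 1, 1, n / 4, e, one_pos, one_dvd _, one_dvd _, one_dvd _,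
      one_dvd _, ?_, ?_, ?_⟩ <;> simp
  · exact (reduce_four hn x hx).trans (reduce_four hn y hy).symm
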